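/- arXiv:1511.00176 — 2 statements merged into one kernel-verified Lean document; each statement's English description precedes it below -/
import Mathlib

section
/- Let W = (W_β)_{β∈ℝ} be any V-lattice filtration on N = N₁ ⊗_{ℂ[z,z⁻¹]} N₂ that is stable under ∇ and satisfies (∇ + β·id)^ν(W_β) ⊆ W_{<β} for some ν ∈ ℕ and all β ∈ ℝ. Under the canonical isomorphism H := M/(z−1)M ≅ H₁ ⊗_ℂ H₂, where H_i := M_i/(z−1)M_i, the irregular Hodge filtration F^irr_β H := image of W_β ∩ M in H satisfies, for every β ∈ ℝ: F^irr_β H = Σ_{β₁+β₂=β} F^irr_{β₁} H₁ ⊗_ℂ F^irr_{β₂} H₂, where F^irr_{β_i} H_i is the image of Vⁱ_{β_i} ∩ M_i in H_i. Consequently gr^{F^irr}_β H ≅ ⊕_{β₁+β₂=β} gr^{F^irr}_{β₁} H₁ ⊗_ℂ gr^{F^irr}_{β₂} H₂. (Proposition 3.2.11 of 'Irregular Hodge theory': tensor product formula for the irregular Hodge filtration.) -/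
noncomputable section

open Submodule Set LaurentPolynomial

open scoped TensorProduct

/-- The ring `ℂ[z,z⁻¹]` of Laurent polynomials. -/
abbrev L : Type := LaurentPolynomial ℂ

variable {N : Type*} [AddCommGroup N] [Module ℂ N]

/-- `M` is (the image of) a finite free `ℂ[z]`-module of rank `r` inside
`N = ℂ[z,z⁻¹] ⊗_{ℂ[z]} M`, where multiplication by `z` is the automorphism `z` of `N`.
This is encoded by `z`-stability of `M` together with the existence of an `r`-element
family `b` of elements of `M` such that `(z^k (b i))` for `k ∈ ℤ` is a `ℂ`-basis of `N`
and `(z^k (b i))` for `k ∈ ℕ` is a `ℂ`-basis of `M`. -/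
def IsFreeLattice (z : N ≃ₗ[ℂ] N) (M : Submodule ℂ N) (r : ℕ) : Prop :=
  (∀ x ∈ M, z x ∈ M) ∧
  ∃ b : Fin r → N,
    LinearIndependent ℂ (fun p : Fin r × ℤ => (z ^ p.2) (b p.1)) ∧
    Submodule.span ℂ (Set.range fun p : Fin r × ℤ => (z ^ p.2) (b p.1)) = ⊤ ∧
    Submodule.span ℂ (Set.range fun p : Fin r × ℕ => (z ^ (p.2 : ℤ)) (b p.1)) = M

/-- A V-lattice filtration on `N` (with jumps in `A + ℤ`, `A ⊆ [0,1)` finite):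
(i) increasing; (ii) `z · V_β = V_{β+1}`; (iii) each `V_β` is stable under `z⁻¹` and
finitely generated over `ℂ[z⁻¹]`; (iv) the `ℂ[z,z⁻¹]`-span of each `V_β` is `N`;
(v) `V_β = V_γ` if `(β,γ] ∩ (A + ℤ) = ∅`. -/
structure IsVLattice (z : N ≃ₗ[ℂ] N) (V : ℝ → Submodule ℂ N) (A : Finset ℝ) : Prop where
  mono : Monotone V
  map_z : ∀ β : ℝ, (V β).map z.toLinearMap = V (β + 1)
  zinv_stable : ∀ β : ℝ, ∀ x ∈ V β, z.symm x ∈ V β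
  fg_zinv : ∀ β : ℝ, ∃ S : Finset N, (S : Set N) ⊆ (V β : Set N) ∧
    V β = Submodule.span ℂ {x : N | ∃ k : ℕ, ∃ s ∈ S, x = (z.symm ^ k) s}
  span_laurent : ∀ β : ℝ, Submodule.span ℂ {x : N | ∃ k : ℤ, ∃ v ∈ V β, x = (z ^ k) v} = ⊤
  jumpsIn : ∀ a ∈ A, (0 : ℝ) ≤ a ∧ a < 1
  jumps : ∀ β γ : ℝ, β ≤ γ →
    (∀ a ∈ A, ∀ k : ℤ, ¬ (β < a + k ∧ a + k ≤ γ)) → V β = V γ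

/-- `V_{<β} := ⋃_{γ < β} V_γ`. -/
def Vlt (V : ℝ → Submodule ℂ N) (β : ℝ) : Submodule ℂ N := ⨆ γ ∈ Set.Iio β, V γ

/-- Multiplication by `z` (the Laurent variable `T 1`) as a `ℂ`-linear automorphism of a
`ℂ[z,z⁻¹]`-module. -/
def zmul (N : Type*) [AddCommGroup N] [Module L N] [Module ℂ N] [IsScalarTower ℂ L N] :
    N ≃ₗ[ℂ] N where
  toFun x := (T 1 : L) • x
  invFun x := (T (-1) : L) • x
  map_add' x y := smul_add _ x y
  map_smul' c x := smul_comm (T 1 : L) c x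
  left_inv x := by show (T (-1) : L) • (T 1 : L) • x = x; rw [smul_smul, ← T_add]; simp
  right_inv x := by show (T 1 : L) • (T (-1) : L) • x = x; rw [smul_smul, ← T_add]; simp

variable {N₁ N₂ : Type*}
  [AddCommGroup N₁] [Module L N₁] [Module ℂ N₁] [IsScalarTower ℂ L N₁]
  [AddCommGroup N₂] [Module L N₂] [Module ℂ N₂] [IsScalarTower ℂ L N₂]

section Real

open Filter Topology

theorem eventually_nhdsGT_no_int_translate (a γ : ℝ) :
    ∀ᶠ δ in 𝓝[>] γ, ∀ k : ℤ, a + k ≤ δ → a + k ≤ γ := by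
  have h : γ < a + (⌊γ - a⌋ + 1) := by linarith [Int.lt_floor_add_one (γ - a)]
  filter_upwards [nhdsWithin_le_nhds (eventually_lt_nhds h)] with δ hδ k hk
  have hk' : k < ⌊γ - a⌋ + 1 := by
    have : (k : ℝ) < ((⌊γ - a⌋ + 1 : ℤ) : ℝ) := by push_cast; linarith
    exact_mod_cast this
  have := Int.le_floor.1 (Int.lt_add_one_iff.1 hk')
  linarith

theorem eventually_nhdsLT_no_int_translate (a γ : ℝ) :
    ∀ᶠ δ in 𝓝[<] γ, ∀ k : ℤ, a + k < γ → a + k ≤ δ := by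
  have h : a + (⌈γ - a⌉ - 1) < γ := by linarith [Int.ceil_lt_add_one (γ - a)]
  filter_upwards [nhdsWithin_le_nhds (eventually_gt_nhds h)] with δ hδ k hk
  have hk' : k < ⌈γ - a⌉ := Int.lt_ceil.2 (by linarith)
  have : (k : ℝ) ≤ ((⌈γ - a⌉ - 1 : ℤ) : ℝ) := by exact_mod_cast Int.le_sub_one_of_lt hk'
  push_cast at this
  linarith

/-- Downward real induction for an upward closed predicate. -/
theorem real_descent {P : ℝ → Prop} (s t : ℝ) (mono : ∀ γ δ, γ ≤ δ → P γ → P δ) (hs : P s)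
    (right : ∀ γ, ∃ δ > γ, P δ → P γ)
    (left : ∀ γ, t < γ → γ ≤ s → P γ → ∃ δ < γ, P δ) : P t := by
  rcases le_or_gt s t with hst | hst
  · exact mono _ _ hst hs
  set S : Set ℝ := {γ | t ≤ γ ∧ P γ} with hS
  have hbdd : BddBelow S := ⟨t, fun _ h => h.1⟩
  have hsS : s ∈ S := ⟨hst.le, hs⟩
  have hle : sInf S ≤ s := csInf_le hbdd hsS
  have hge : t ≤ sInf S := le_csInf ⟨s, hsS⟩ fun _ h => h.1
  have hP : P (sInf S) := by
    obtain ⟨δ, hδ, himp⟩ := right (sInf S)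
    obtain ⟨γ, hγ, hγδ⟩ := exists_lt_of_csInf_lt ⟨s, hsS⟩ hδ
    exact himp (mono _ _ hγδ.le hγ.2)
  rcases hge.eq_or_lt with h | h
  · exact h ▸ hP
  · obtain ⟨δ, hδ, hPδ⟩ := left _ h hle hP
    have : max δ t ∈ S := ⟨le_max_right _ _, mono _ _ (le_max_left _ _) hPδ⟩
    exact absurd (csInf_le hbdd this) (not_le.2 (max_lt hδ h))

end Real

theorem le_Vlt (V : ℝ → Submodule ℂ N) {γ β : ℝ} (h : γ < β) : V γ ≤ Vlt V β :=
  le_iSup₂_of_le γ h le_rfl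

theorem Vlt_le {V : ℝ → Submodule ℂ N} (hV : Monotone V) (β : ℝ) : Vlt V β ≤ V β :=
  iSup₂_le fun _ h => hV (le_of_lt h)

section Filtrations

variable {E : Type*} [AddCommGroup E] [Module L E]

theorem T_smul_T_smul (m n : ℤ) (x : E) : (T m : L) • (T n : L) • x = (T (m + n) : L) • x := by
  rw [smul_smul, ← T_add]

theorem T_neg_smul_T_smul (m : ℤ) (x : E) : (T (-m) : L) • (T m : L) • x = x := by
  rw [T_smul_T_smul, neg_add_cancel, T_zero, one_smul]

theorem T_smul_T_neg_smul (m : ℤ) (x : E) : (T m : L) • (T (-m) : L) • x = x := by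
  rw [T_smul_T_smul, add_neg_cancel, T_zero, one_smul]

variable [Module ℂ E]

/-- An exhaustive increasing real filtration which is locally constant on both sides of every
point and is shifted by `1` under multiplication by `z`. -/
structure IsShiftFiltration (V : ℝ → Submodule ℂ E) : Prop where
  mono : Monotone V
  shift : ∀ (β : ℝ) (k : ℤ) (x : E), x ∈ V β → (T k : L) • x ∈ V (β + k)
  right : ∀ β : ℝ, ∃ γ > β, V γ ≤ V β
  left : ∀ β : ℝ, ∃ γ < β, Vlt V β ≤ V γ
  exhaust : ∀ x : E, ∃ β, x ∈ V β

theorem IsShiftFiltration.mem_Vlt {V : ℝ → Submodule ℂ E} (hV : IsShiftFiltration V) {β : ℝ}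
    {x : E} : x ∈ Vlt V β ↔ ∃ γ < β, x ∈ V γ := by
  constructor
  · obtain ⟨γ, hγ, h⟩ := hV.left β
    exact fun hx => ⟨γ, hγ, h hx⟩
  · rintro ⟨γ, hγ, hx⟩
    exact le_Vlt V hγ hx

/-- The filtration spanned by the `z ^ k • e i` with `k + deg i ≤ β`. -/
def degFiltration {ι : Type*} (e : ι → E) (deg : ι → ℝ) (β : ℝ) : Submodule ℂ E :=
  Submodule.span ℂ {x | ∃ i, ∃ k : ℤ, deg i + k ≤ β ∧ x = (T k : L) • e i}

theorem T_smul_mem_degFiltration {ι : Type*} (e : ι → E) (deg : ι → ℝ) {β : ℝ} {i : ι} {k : ℤ}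
    (h : deg i + k ≤ β) : (T k : L) • e i ∈ degFiltration e deg β :=
  Submodule.subset_span ⟨i, k, h, rfl⟩

theorem degFiltration_le {ι : Type*} {e : ι → E} {deg : ι → ℝ} {β : ℝ} {S : Submodule ℂ E}
    (h : ∀ i, ∀ k : ℤ, deg i + k ≤ β → (T k : L) • e i ∈ S) : degFiltration e deg β ≤ S := by
  refine Submodule.span_le.2 ?_
  rintro _ ⟨i, k, hk, rfl⟩
  exact h i k hk

theorem T_natCast_smul_mem {M : Submodule ℂ E} (hM : ∀ x ∈ M, (T 1 : L) • x ∈ M) (k : ℕ)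
    {x : E} (hx : x ∈ M) : (T (k : ℤ) : L) • x ∈ M := by
  induction k with
  | zero => simpa using hx
  | succ k ih =>
    have := hM _ ih
    rw [T_smul_T_smul] at this
    rwa [Nat.cast_succ, add_comm]

/-- The filtration spanned by the `z ^ k • e i` with `0 ≤ k` and `k + deg i ≤ β`. -/
def natDegFiltration {ι : Type*} (e : ι → E) (deg : ι → ℝ) (β : ℝ) : Submodule ℂ E :=
  Submodule.span ℂ {x | ∃ i, ∃ k : ℕ, deg i + k ≤ β ∧ x = (T (k : ℤ) : L) • e i}

theorem natDegFiltration_mono {ι : Type*} (e : ι → E) (deg : ι → ℝ) :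
    Monotone (natDegFiltration e deg) := fun β γ h => by
  refine Submodule.span_mono ?_
  rintro _ ⟨i, k, hk, rfl⟩
  exact ⟨i, k, hk.trans h, rfl⟩

theorem IsShiftFiltration.exists_degFiltration_le {V : ℝ → Submodule ℂ E}
    (hV : IsShiftFiltration V) {ι : Type*} [Finite ι] (e : ι → E) (deg : ι → ℝ) :
    ∃ c, ∀ β, degFiltration e deg β ≤ V (β + c) := by
  choose d hd using fun i => hV.exhaust (e i)
  obtain ⟨c, hc⟩ := (Set.finite_range fun i => d i - deg i).bddAbove
  refine ⟨c, fun β => degFiltration_le fun i k hk => ?_⟩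
  have : d i - deg i ≤ c := hc ⟨i, rfl⟩
  exact hV.mono (by linarith) (hV.shift (d i) k _ (hd i))

/-- Uniqueness of the canonical filtration of a regular singularity, as an inclusion. -/
theorem le_of_regular {U W : ℝ → Submodule ℂ E} (hU : IsShiftFiltration U)
    (hW : IsShiftFiltration W) (nab : E →ₗ[ℂ] E) (hWnab : ∀ β, ∀ x ∈ W β, nab x ∈ W β)
    {ν μ : ℕ}
    (hUnil : ∀ β : ℝ, ∀ x ∈ U β,
      ((nab + (β : ℂ) • (LinearMap.id : E →ₗ[ℂ] E)) ^ μ) x ∈ Vlt U β)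
    (hWnil : ∀ β : ℝ, ∀ x ∈ W β,
      ((nab + (β : ℂ) • (LinearMap.id : E →ₗ[ℂ] E)) ^ ν) x ∈ Vlt W β)
    (hUW : ∃ c, ∀ β, U β ≤ W (β + c)) (β : ℝ) : U β ≤ W β := by
  obtain ⟨c, hc⟩ := hUW
  have haeval : ∀ (γ : ℝ) (n : ℕ),
      Polynomial.aeval nab ((Polynomial.X - Polynomial.C (-(γ : ℂ))) ^ n) =
        (nab + (γ : ℂ) • (LinearMap.id : E →ₗ[ℂ] E)) ^ n := by
    intro γ n
    rw [map_pow, map_sub, Polynomial.aeval_X, Polynomial.aeval_C, map_neg, sub_neg_eq_add,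
      Algebra.algebraMap_eq_smul_one]
    rfl
  have hWpoly : ∀ (γ : ℝ) (p : Polynomial ℂ), ∀ x ∈ W γ, Polynomial.aeval nab p x ∈ W γ := by
    intro γ p x hx
    induction p using Polynomial.induction_on' with
    | add p q hp hq => rw [map_add]; exact add_mem hp hq
    | monomial n a =>
      rw [Polynomial.aeval_monomial, Module.End.mul_apply, Module.algebraMap_end_apply]
      exact (W γ).smul_mem a (Module.End.pow_apply_mem_of_forall_mem n (hWnab γ) x hx)
  have hannih : ∀ t : ℝ, ∃ p : Polynomial ℂ, (∀ r : ℝ, p.eval (-(r : ℂ)) = 0 → r ≤ β) ∧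
      ∀ x ∈ U β, Polynomial.aeval nab p x ∈ U t := by
    intro t
    refine real_descent (P := fun t => ∃ p : Polynomial ℂ,
      (∀ r : ℝ, p.eval (-(r : ℂ)) = 0 → r ≤ β) ∧
        ∀ x ∈ U β, Polynomial.aeval nab p x ∈ U t) β t ?_ ?_ ?_ ?_
    · rintro γ δ h ⟨p, hp, hpU⟩
      exact ⟨p, hp, fun x hx => hU.mono h (hpU x hx)⟩
    · exact ⟨1, by simp, by simp⟩
    · intro γ
      obtain ⟨δ, hδ, h⟩ := hU.right γ
      exact ⟨δ, hδ, fun ⟨p, hp, hpU⟩ => ⟨p, hp, fun x hx => h (hpU x hx)⟩⟩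
    · rintro γ - hγ ⟨p, hp, hpU⟩
      obtain ⟨δ, hδ, h⟩ := hU.left γ
      refine ⟨δ, hδ, (Polynomial.X - Polynomial.C (-(γ : ℂ))) ^ μ * p, fun r hr => ?_,
        fun x hx => ?_⟩
      · rw [Polynomial.eval_mul, mul_eq_zero] at hr
        rcases hr with hr | hr
        · rw [Polynomial.eval_pow] at hr
          have := eq_zero_of_pow_eq_zero hr
          simp only [Polynomial.eval_sub, Polynomial.eval_X, Polynomial.eval_C] at this
          have h2 : (r : ℂ) = γ := by linear_combination -this
          exact (Complex.ofReal_injective h2).trans_le hγ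
        · exact hp r hr
      · rw [map_mul, haeval, Module.End.mul_apply]
        exact h (hUnil γ _ (hpU x hx))
  refine real_descent (P := fun t => U β ≤ W t) (β + c) β (fun γ δ h h' => h'.trans (hW.mono h))
    (hc β) (fun γ => ?_) fun γ hγ _ hUγ => ?_
  · obtain ⟨δ, hδ, h⟩ := hW.right γ
    exact ⟨δ, hδ, fun h' => h'.trans h⟩
  · obtain ⟨δ, hδ, h⟩ := hW.left γ
    refine ⟨δ, hδ, fun x hx => ?_⟩
    obtain ⟨p, hp, hpU⟩ := hannih (δ - c)
    have hcop : IsCoprime ((Polynomial.X - Polynomial.C (-(γ : ℂ))) ^ ν) p := by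
      refine IsCoprime.pow_left ?_
      rw [(Polynomial.irreducible_X_sub_C _).coprime_iff_not_dvd, Polynomial.dvd_iff_isRoot]
      exact fun hroot => absurd (hp γ hroot) (not_le.2 hγ)
    obtain ⟨a, b, hab⟩ := hcop
    have hx' : x = Polynomial.aeval nab (a * (Polynomial.X - Polynomial.C (-(γ : ℂ))) ^ ν + b * p) x := by
      rw [hab]; simp
    rw [hx', map_add, map_mul, map_mul, haeval, LinearMap.add_apply, Module.End.mul_apply,
      Module.End.mul_apply]
    refine add_mem (hWpoly _ _ _ (h (hWnil γ x (hUγ hx)))) (hWpoly _ _ _ ?_)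
    simpa using hc _ (hpU x hx)

variable [IsScalarTower ℂ L E]

/-- Multiplication by `z ^ k` as a `ℂ`-linear map. -/
def zpowMul (E : Type*) [AddCommGroup E] [Module L E] [Module ℂ E] [IsScalarTower ℂ L E]
    (k : ℤ) : E →ₗ[ℂ] E := ((LinearMap.lsmul L E (T k : L)).restrictScalars ℂ)

@[simp]
theorem zpowMul_apply (k : ℤ) (x : E) : zpowMul E k x = (T k : L) • x := rfl

theorem zmul_apply (x : E) : zmul E x = (T 1 : L) • x := rfl

theorem zmul_symm_pow_apply (k : ℕ) (x : E) : ((zmul E).symm ^ k) x = (T (-k) : L) • x := by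
  induction k with
  | zero => simp
  | succ k ih =>
    rw [pow_succ', LinearEquiv.mul_apply, ih]
    change (T (-1) : L) • (T (-(k : ℤ)) : L) • x = _
    rw [smul_smul, ← T_add]
    congr 2
    push_cast
    ring

theorem zmul_pow_apply (k : ℕ) (x : E) : ((zmul E) ^ k) x = (T k : L) • x := by
  induction k with
  | zero => simp
  | succ k ih =>
    rw [pow_succ', LinearEquiv.mul_apply, ih, zmul_apply, T_smul_T_smul]
    congr 2
    push_cast
    ring

theorem zmul_zpow_apply (k : ℤ) (x : E) : ((zmul E) ^ k) x = (T k : L) • x := by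
  cases k with
  | ofNat k => simpa using zmul_pow_apply k x
  | negSucc k =>
    rw [zpow_negSucc, ← inv_pow]
    have h := zmul_symm_pow_apply (k + 1) x
    rw [Int.negSucc_eq]
    exact_mod_cast h

theorem IsVLattice.T_smul_mem {V : ℝ → Submodule ℂ E} {A : Finset ℝ}
    (hV : IsVLattice (zmul E) V A) (β : ℝ) (k : ℤ) (x : E) (hx : x ∈ V β) :
    (T k : L) • x ∈ V (β + k) := by
  induction k using Int.induction_on with
  | zero => simpa using hx
  | succ k ih =>
    have : zmul E ((T k : L) • x) ∈ V (β + k + 1) := by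
      rw [← hV.map_z]; exact Submodule.mem_map_of_mem (by simpa using ih)
    rw [zmul_apply, T_smul_T_smul] at this
    convert this using 2
    · push_cast; ring
    · congr 1; ring_nf
  | pred k ih =>
    have h1 := hV.map_z (β + (-k - 1 : ℤ))
    have : (T (-k) : L) • x ∈ V (β + (-k - 1 : ℤ) + 1) := by
      convert ih using 2; push_cast; ring
    rw [← h1] at this
    obtain ⟨y, hy, hyx⟩ := this
    have : (T (-k - 1) : L) • x = y := by
      have h2 : (T 1 : L) • y = (T (-k) : L) • x := hyx
      rw [← T_neg_smul_T_smul 1 y, h2, T_smul_T_smul]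
      congr 2; ring
    rwa [this]

theorem IsVLattice.exists_mem {V : ℝ → Submodule ℂ E} {A : Finset ℝ}
    (hV : IsVLattice (zmul E) V A) (x : E) : ∃ β, x ∈ V β := by
  have hx : x ∈ Submodule.span ℂ {x : E | ∃ k : ℤ, ∃ v ∈ V 0, x = (zmul E ^ k) v} :=
    hV.span_laurent 0 ▸ Submodule.mem_top
  have hle : Submodule.span ℂ {x : E | ∃ k : ℤ, ∃ v ∈ V 0, x = (zmul E ^ k) v} ≤ ⨆ β, V β := by
    refine Submodule.span_le.2 ?_
    rintro _ ⟨k, v, hv, rfl⟩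
    rw [zmul_zpow_apply]
    exact (le_iSup V _) (hV.T_smul_mem 0 k v hv)
  exact (Submodule.mem_iSup_of_directed V hV.mono.directed_le).1 (hle hx)

theorem IsVLattice.isShiftFiltration {V : ℝ → Submodule ℂ E} {A : Finset ℝ}
    (hV : IsVLattice (zmul E) V A) : IsShiftFiltration V where
  mono := hV.mono
  shift := hV.T_smul_mem
  right β := by
    have h := (Filter.eventually_all_finset A).2 fun a _ => eventually_nhdsGT_no_int_translate a β
    obtain ⟨γ, h, hγ⟩ := (h.and self_mem_nhdsWithin).exists
    refine ⟨γ, hγ, (hV.jumps β γ (le_of_lt hγ) fun a ha k hk => ?_).ge⟩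
    exact absurd (h a ha k hk.2) (not_le.2 hk.1)
  left β := by
    have h := (Filter.eventually_all_finset A).2 fun a _ => eventually_nhdsLT_no_int_translate a β
    obtain ⟨γ, h, hγ⟩ := (h.and self_mem_nhdsWithin).exists
    refine ⟨γ, hγ, iSup₂_le fun δ hδ => ?_⟩
    rcases le_total δ γ with h' | h'
    · exact hV.mono h'
    · refine (hV.jumps γ δ h' fun a ha k hk => ?_).ge
      exact absurd (h a ha k (hk.2.trans_lt hδ)) (not_le.2 hk.1)
  exhaust := hV.exists_mem

theorem isShiftFiltration_degFiltration {ι : Type*} [Finite ι] (e : ι → E) (deg : ι → ℝ)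
    (he : Submodule.span ℂ (Set.range fun p : ι × ℤ => (T p.2 : L) • e p.1) = ⊤) :
    IsShiftFiltration (degFiltration e deg) := by
  have hmono : Monotone (degFiltration e deg) := fun β γ h =>
    degFiltration_le fun i k hk => T_smul_mem_degFiltration e deg (hk.trans h)
  refine ⟨hmono, fun β k x hx => ?_, fun β => ?_, fun β => ?_, fun x => ?_⟩
  · have : degFiltration e deg β ≤ (degFiltration e deg (β + k)).comap (zpowMul E k) := by
      refine degFiltration_le fun i l hl => ?_
      rw [Submodule.mem_comap, zpowMul_apply, T_smul_T_smul]
      exact T_smul_mem_degFiltration e deg (by push_cast; linarith)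
    exact this hx
  · have h := Filter.eventually_all.2 fun i => eventually_nhdsGT_no_int_translate (deg i) β
    obtain ⟨γ, h, hγ⟩ := (h.and self_mem_nhdsWithin).exists
    exact ⟨γ, hγ, degFiltration_le fun i k hk => T_smul_mem_degFiltration e deg (h i k hk)⟩
  · have h := Filter.eventually_all.2 fun i => eventually_nhdsLT_no_int_translate (deg i) β
    obtain ⟨γ, h, hγ⟩ := (h.and self_mem_nhdsWithin).exists
    exact ⟨γ, hγ, iSup₂_le fun δ hδ => degFiltration_le fun i k hk =>
      T_smul_mem_degFiltration e deg (h i k (hk.trans_lt hδ))⟩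
  · have hle : (⊤ : Submodule ℂ E) ≤ ⨆ β, degFiltration e deg β := by
      rw [← he, Submodule.span_le]
      rintro _ ⟨p, rfl⟩
      exact (le_iSup (degFiltration e deg) _) (T_smul_mem_degFiltration e deg le_rfl)
    exact (Submodule.mem_iSup_of_directed _ hmono.directed_le).1 (hle Submodule.mem_top)

theorem IsVLattice.exists_le {V W : ℝ → Submodule ℂ E} {A : Finset ℝ}
    (hV : IsVLattice (zmul E) V A) (hW : IsShiftFiltration W) : ∃ c, ∀ β, V β ≤ W (β + c) := by
  obtain ⟨S, -, hS⟩ := hV.fg_zinv 0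
  choose d hd using hW.exhaust
  obtain ⟨c, hc⟩ := (S.finite_toSet.image d).bddAbove
  have h0 : V 0 ≤ W c := by
    rw [hS, Submodule.span_le]
    rintro _ ⟨k, s, hs, rfl⟩
    rw [zmul_symm_pow_apply]
    have h1 : d s ≤ c := hc ⟨s, hs, rfl⟩
    refine hW.mono ?_ (hW.shift (d s) (-k) s (hd s))
    have : (0 : ℝ) ≤ k := k.cast_nonneg
    push_cast
    linarith
  refine ⟨c + 1, fun β x hx => ?_⟩
  have h1 : (T (-⌈β⌉) : L) • x ∈ V 0 :=
    hV.mono (by push_cast; linarith [Int.le_ceil β]) (hV.T_smul_mem β (-⌈β⌉) x hx)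
  have h2 := hW.shift _ ⌈β⌉ _ (h0 h1)
  rw [T_smul_T_neg_smul] at h2
  exact hW.mono (by linarith [Int.ceil_lt_add_one β]) h2

theorem laurent_smul_eq_sum (p : L) (x : E) :
    p • x = ∑ k ∈ p.coeff.support, p.coeff k • (T k : L) • x := by
  have hp : p = ∑ k ∈ p.coeff.support, p.coeff k • (T k : L) := by
    have h := (AddMonoidAlgebra.basis ℤ ℂ).linearCombination_repr p
    rw [Finsupp.linearCombination_apply, Finsupp.sum] at h
    simp only [AddMonoidAlgebra.basis_apply] at h
    exact h.symm
  conv_lhs => rw [hp, Finset.sum_smul]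
  exact Finset.sum_congr rfl fun k _ => smul_assoc _ _ _

/-- The elements of degree `β` in `M` that come from lower degree, either because they already lie
in a smaller step of the filtration or because they are multiples of `z`. -/
def decomposablePart (V : ℝ → Submodule ℂ E) (M : Submodule ℂ E) (β : ℝ) : Submodule ℂ E :=
  (Vlt V β ⊓ M) ⊔ (V (β - 1) ⊓ M).map (zpowMul E 1)

/-- `C β` is a complement of the decomposable part of `V β ⊓ M`. -/
structure IsPrimitivePart (V : ℝ → Submodule ℂ E) (M : Submodule ℂ E)
    (C : ℝ → Submodule ℂ E) : Prop where
  le_inf : ∀ β, C β ≤ V β ⊓ M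
  le_sup : ∀ β, V β ⊓ M ≤ decomposablePart V M β ⊔ C β
  disjoint : ∀ β, Disjoint (decomposablePart V M β) (C β)

theorem exists_isPrimitivePart {V : ℝ → Submodule ℂ E} (hV : IsShiftFiltration V)
    {M : Submodule ℂ E} (hM : ∀ x ∈ M, (T 1 : L) • x ∈ M) :
    ∃ C, IsPrimitivePart V M C := by
  choose C hC using fun β => Submodule.exists_isCompl (decomposablePart V M β)
  have hle : ∀ β, decomposablePart V M β ≤ V β ⊓ M := fun β => by
    refine sup_le (inf_le_inf_right _ (Vlt_le hV.mono β)) ?_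
    rintro _ ⟨x, hx, rfl⟩
    refine ⟨?_, hM x hx.2⟩
    have := hV.shift _ 1 x hx.1
    simpa using this
  refine ⟨fun β => C β ⊓ (V β ⊓ M), fun β => inf_le_right, fun β => ?_, fun β => ?_⟩
  · rw [← sup_inf_assoc_of_le _ (hle β), (hC β).sup_eq_top, top_inf_eq]
  · exact (hC β).disjoint.mono_right inf_le_left

theorem IsPrimitivePart.linearIndependent {V : ℝ → Submodule ℂ E} (hV : IsShiftFiltration V)
    {M : Submodule ℂ E} (hM : ∀ x ∈ M, (T 1 : L) • x ∈ M) {C : ℝ → Submodule ℂ E}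
    (hC : IsPrimitivePart V M C) {ι : Type*} (e : ι → E) (deg : ι → ℝ)
    (he : ∀ i, e i ∈ C (deg i))
    (hind : ∀ d, LinearIndependent ℂ fun i : {i // deg i = d} => e i) :
    LinearIndependent L e := by
  classical
  rw [linearIndependent_iff']
  intro s g hg
  by_contra! hne
  obtain ⟨i, his, hi⟩ := hne
  set S := s.sigma fun i => (g i).coeff.support with hS
  have hSne : S.Nonempty := by
    have : (g i).coeff.support.Nonempty := by
      rw [Finsupp.support_nonempty_iff]
      intro h
      exact hi (LaurentPolynomial.ext fun a => by rw [h]; rfl)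
    obtain ⟨k, hk⟩ := this
    exact ⟨⟨i, k⟩, Finset.mem_sigma.2 ⟨his, hk⟩⟩
  obtain ⟨p₀, hp₀, hmax⟩ := S.exists_max_image
    (fun p => toLex ((deg p.1 + p.2 : ℝ), -p.2)) hSne
  set d := deg p₀.1 with hd
  set k₀ := p₀.2 with hk₀
  have hcases : ∀ p ∈ S, deg p.1 + p.2 < d + k₀ ∨ (deg p.1 + p.2 = d + k₀ ∧ k₀ ≤ p.2) := by
    intro p hp
    have := hmax p hp
    rw [Prod.Lex.toLex_le_toLex] at this
    simpa using this
  set a : (Σ _ : ι, ℤ) → ℂ := fun p => (g p.1).coeff p.2 with ha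
  set w : (Σ _ : ι, ℤ) → E := fun p => a p • (T (p.2 - k₀) : L) • e p.1 with hw
  have hsum : ∑ p ∈ S, w p = 0 := by
    have h0 : ∑ p ∈ S, a p • (T p.2 : L) • e p.1 = 0 := by
      rw [hS, Finset.sum_sigma, ← hg]
      exact Finset.sum_congr rfl fun i _ => (laurent_smul_eq_sum (g i) (e i)).symm
    have h1 := congrArg (zpowMul E (-k₀)) h0
    rw [map_sum, map_zero] at h1
    rw [← h1]
    refine Finset.sum_congr rfl fun p _ => ?_
    rw [map_smul, zpowMul_apply, T_smul_T_smul, neg_add_eq_sub]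
  have hwM : ∀ p, k₀ ≤ p.2 → w p ∈ M := by
    intro p hp
    refine M.smul_mem _ ?_
    obtain ⟨n, hn⟩ := Int.eq_ofNat_of_zero_le (sub_nonneg.2 hp)
    rw [hn]
    exact T_natCast_smul_mem hM n (hC.le_inf _ (he p.1)).2
  set S₁ := S.filter fun p => p.2 = k₀ ∧ deg p.1 = d with hS₁
  set R := S.filter fun p => ¬(p.2 = k₀ ∧ deg p.1 = d) with hR
  set S₃ := R.filter fun p => deg p.1 + p.2 < d + k₀ with hS₃
  set S₂ := R.filter fun p => ¬(deg p.1 + p.2 < d + k₀) with hS₂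
  have hsplit : ∑ p ∈ S₁, w p + (∑ p ∈ S₃, w p + ∑ p ∈ S₂, w p) = 0 := by
    rw [Finset.sum_filter_add_sum_filter_not, Finset.sum_filter_add_sum_filter_not, hsum]
  have h₁ : ∑ p ∈ S₁, w p ∈ C d := by
    refine sum_mem fun p hp => (C d).smul_mem _ ?_
    obtain ⟨-, hpk, hpd⟩ := Finset.mem_filter.1 hp
    rw [hpk, sub_self, T_zero, one_smul, ← hpd]
    exact he p.1
  have h₂ : ∑ p ∈ S₂, w p ∈ (V (d - 1) ⊓ M).map (zpowMul E 1) := by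
    refine sum_mem fun p hp => Submodule.smul_mem _ _ ?_
    obtain ⟨hpR, hlt⟩ := Finset.mem_filter.1 hp
    obtain ⟨hpS, hne⟩ := Finset.mem_filter.1 hpR
    obtain ⟨heq, hle⟩ := (hcases p hpS).resolve_left hlt
    have hlt' : k₀ < p.2 := by
      refine lt_of_le_of_ne hle fun h => hne ⟨h.symm, ?_⟩
      rw [← h] at heq
      linarith
    obtain ⟨n, hn⟩ := Int.eq_ofNat_of_zero_le (sub_nonneg.2 (Int.add_one_le_of_lt hlt'))
    refine ⟨(T (n : ℤ) : L) • e p.1, ⟨?_, T_natCast_smul_mem hM n (hC.le_inf _ (he p.1)).2⟩, ?_⟩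
    · have := hV.shift _ (n : ℤ) _ (hC.le_inf _ (he p.1)).1
      have hn' : (p.2 : ℝ) - (k₀ + 1) = ((n : ℤ) : ℝ) := by exact_mod_cast hn
      rwa [show deg p.1 + ((n : ℤ) : ℝ) = d - 1 by linarith] at this
    · rw [zpowMul_apply, T_smul_T_smul]
      congr 2
      omega
  have h₃ : ∑ p ∈ S₃, w p ∈ Vlt V d := by
    refine sum_mem fun p hp => Submodule.smul_mem _ _ ?_
    obtain ⟨hpR, hlt⟩ := Finset.mem_filter.1 hp
    refine hV.mem_Vlt.2 ⟨_, ?_, hV.shift _ _ _ (hC.le_inf _ (he p.1)).1⟩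
    push_cast
    linarith
  have h₃M : ∑ p ∈ S₃, w p ∈ M := by
    have hmem : ∑ p ∈ S₁, w p + ∑ p ∈ S₂, w p ∈ M := by
      refine add_mem (sum_mem fun p hp => hwM p ?_) (sum_mem fun p hp => hwM p ?_)
      · exact (Finset.mem_filter.1 hp).2.1.ge
      · obtain ⟨hpR, hlt⟩ := Finset.mem_filter.1 hp
        exact ((hcases p (Finset.mem_filter.1 hpR).1).resolve_left hlt).2
    have : ∑ p ∈ S₃, w p = -(∑ p ∈ S₁, w p + ∑ p ∈ S₂, w p) := by
      rw [eq_neg_iff_add_eq_zero, ← hsplit]; abel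
    rw [this]
    exact neg_mem hmem
  have hzero : ∑ p ∈ S₁, w p = 0 := by
    refine (Submodule.disjoint_def.1 (hC.disjoint d)) _ ?_ h₁
    rw [eq_neg_of_add_eq_zero_left hsplit]
    exact neg_mem (add_mem (Submodule.mem_sup_left ⟨h₃, h₃M⟩) (Submodule.mem_sup_right h₂))
  have hli := (hind d).comp (fun p : S₁ => ⟨p.1.1, (Finset.mem_filter.1 p.2).2.2⟩) <| by
    rintro ⟨⟨i, k⟩, hp⟩ ⟨⟨j, l⟩, hq⟩ h
    have h1 : i = j := congrArg Subtype.val h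
    have h2 : k = l := (Finset.mem_filter.1 hp).2.1.trans (Finset.mem_filter.1 hq).2.1.symm
    subst h1 h2
    rfl
  have hp₀S : p₀ ∈ S₁ := Finset.mem_filter.2 ⟨hp₀, rfl, rfl⟩
  have := Fintype.linearIndependent_iff.1 hli (fun p => a p) (by
    rw [← hzero, ← Finset.sum_coe_sort S₁]
    refine Finset.sum_congr rfl fun p _ => ?_
    simp only [hw, Function.comp_apply]
    rw [(Finset.mem_filter.1 p.2).2.1, sub_self, T_zero, one_smul]) ⟨p₀, hp₀S⟩
  exact Finsupp.mem_support_iff.1 (Finset.mem_sigma.1 hp₀).2 this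

theorem map_natDegFiltration_le {ι : Type*} (e : ι → E) (deg : ι → ℝ) (β : ℝ) :
    (natDegFiltration e deg β).map (zpowMul E 1) ≤ natDegFiltration e deg (β + 1) := by
  rw [natDegFiltration, Submodule.map_span, Submodule.span_le]
  rintro _ ⟨_, ⟨i, k, hk, rfl⟩, rfl⟩
  refine Submodule.subset_span ⟨i, k + 1, by push_cast; linarith, ?_⟩
  rw [zpowMul_apply, T_smul_T_smul, Nat.cast_succ, add_comm]

theorem IsPrimitivePart.le_natDegFiltration {V : ℝ → Submodule ℂ E} (hV : IsShiftFiltration V)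
    {M : Submodule ℂ E} (hbot : ∃ β, V β ⊓ M = ⊥) {C : ℝ → Submodule ℂ E}
    (hC : IsPrimitivePart V M C) {ι : Type*} (e : ι → E) (deg : ι → ℝ)
    (hspan : ∀ d, C d ≤ Submodule.span ℂ {x | ∃ i, deg i = d ∧ x = e i}) (β : ℝ) :
    V β ⊓ M ≤ natDegFiltration e deg β := by
  obtain ⟨β₀, hβ₀⟩ := hbot
  have hCle : ∀ d, C d ≤ natDegFiltration e deg d := fun d => by
    refine (hspan d).trans (Submodule.span_mono ?_)
    rintro _ ⟨i, hi, rfl⟩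
    exact ⟨i, 0, by simp [hi], by simp⟩
  have key : ∀ (n : ℕ) (β : ℝ), β ≤ β₀ + n → V β ⊓ M ≤ natDegFiltration e deg β := by
    intro n
    induction n with
    | zero =>
      intro β hβ
      have : V β ⊓ M ≤ ⊥ := hβ₀ ▸ inf_le_inf_right M (hV.mono (by simpa using hβ))
      exact this.trans bot_le
    | succ n ih =>
      intro β hβ
      have := real_descent (P := fun γ => V β ⊓ M ≤ (V γ ⊓ M) ⊔ natDegFiltration e deg β) β β₀
        (fun γ δ h h' => h'.trans (sup_le_sup_right (inf_le_inf_right _ (hV.mono h)) _))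
        le_sup_left (fun γ => ?_) fun γ _ hγ h => ?_
      · rwa [hβ₀, bot_sup_eq] at this
      · obtain ⟨δ, hδ, h⟩ := hV.right γ
        exact ⟨δ, hδ, fun h' => h'.trans (sup_le_sup_right (inf_le_inf_right _ h) _)⟩
      · obtain ⟨δ, hδ, hlt⟩ := hV.left γ
        refine ⟨δ, hδ, h.trans (sup_le ((hC.le_sup γ).trans ?_) le_sup_right)⟩
        refine sup_le (sup_le (le_sup_of_le_left (inf_le_inf_right _ hlt)) ?_) ?_
        · refine le_sup_of_le_right ?_
          have h1 := ih (γ - 1) (by push_cast at hβ; linarith)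
          refine (Submodule.map_mono h1).trans ((map_natDegFiltration_le e deg _).trans ?_)
          exact natDegFiltration_mono e deg (by linarith)
        · exact le_sup_of_le_right ((hCle γ).trans (natDegFiltration_mono e deg hγ))
  obtain ⟨n, hn⟩ := exists_nat_ge (β - β₀)
  exact key n β (by linarith)

/-- A lattice and a filtration on the same module admit a common homogeneous basis. -/
theorem IsShiftFiltration.exists_adapted_basis.{u} {E : Type u} [AddCommGroup E] [Module L E]
    [Module ℂ E] [IsScalarTower ℂ L E] [Module.Finite L E] {V : ℝ → Submodule ℂ E}
    (hV : IsShiftFiltration V) {M : Submodule ℂ E} (hM : ∀ x ∈ M, (T 1 : L) • x ∈ M)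
    (hgen : ∀ x : E, ∃ n : ℤ, (T n : L) • x ∈ M) (hbot : ∃ β, V β ⊓ M = ⊥) :
    ∃ (ι : Type u) (_ : Finite ι) (B : Module.Basis ι L E) (deg : ι → ℝ),
      M = Submodule.span ℂ (Set.range fun p : ι × ℕ => (T (p.2 : ℤ) : L) • B p.1) ∧
        V = degFiltration B deg := by
  obtain ⟨C, hC⟩ := exists_isPrimitivePart hV hM
  let ι := Σ d : ℝ, Module.Basis.ofVectorSpaceIndex ℂ (C d)
  let e : ι → E := fun i => (Module.Basis.ofVectorSpace ℂ (C i.1) i.2 : C i.1)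
  let deg : ι → ℝ := fun i => i.1
  have he : ∀ i, e i ∈ C (deg i) := fun i => Subtype.property _
  have hind : ∀ d, LinearIndependent ℂ fun i : {i // deg i = d} => e i := by
    intro d
    have h := (Module.Basis.ofVectorSpace ℂ (C d)).linearIndependent.map' (C d).subtype
      (Submodule.ker_subtype _)
    have hsurj : Function.Surjective
        (fun j : Module.Basis.ofVectorSpaceIndex ℂ (C d) => (⟨⟨d, j⟩, rfl⟩ : {i // deg i = d})) := by
      rintro ⟨⟨d', j⟩, rfl⟩
      exact ⟨j, rfl⟩
    have hinj : Function.Injective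
        (fun j : Module.Basis.ofVectorSpaceIndex ℂ (C d) => (⟨⟨d, j⟩, rfl⟩ : {i // deg i = d})) := by
      intro j k hjk
      exact eq_of_heq (Sigma.mk.inj (congrArg Subtype.val hjk)).2
    exact (linearIndependent_equiv (Equiv.ofBijective _ ⟨hinj, hsurj⟩)).1 h
  have hspan : ∀ d, C d ≤ Submodule.span ℂ {x | ∃ i, deg i = d ∧ x = e i} := by
    intro d x hx
    have h : (⟨x, hx⟩ : C d) ∈ Submodule.span ℂ (Set.range (Module.Basis.ofVectorSpace ℂ (C d))) := by
      rw [Module.Basis.span_eq]; trivial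
    have h' := Submodule.mem_map_of_mem (f := (C d).subtype) h
    rw [Submodule.map_span] at h'
    refine Submodule.span_mono ?_ h'
    rintro _ ⟨_, ⟨j, rfl⟩, rfl⟩
    exact ⟨⟨d, j⟩, rfl, rfl⟩
  have hle := hC.le_natDegFiltration hV hbot e deg hspan
  have hli := hC.linearIndependent hV hM e deg he hind
  have htop : ⊤ ≤ Submodule.span L (Set.range e) := by
    intro x _
    obtain ⟨n, hn⟩ := hgen x
    obtain ⟨γ, hγ⟩ := hV.exhaust ((T n : L) • x)
    have h1 := hle γ ⟨hγ, hn⟩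
    have h2 : natDegFiltration e deg γ ≤ (Submodule.span L (Set.range e)).restrictScalars ℂ := by
      refine Submodule.span_le.2 ?_
      rintro _ ⟨i, k, -, rfl⟩
      exact Submodule.smul_mem _ _ (Submodule.subset_span (Set.mem_range_self i))
    rw [← T_neg_smul_T_smul n x]
    exact Submodule.smul_mem _ _ (h2 h1)
  let B := Module.Basis.mk hli htop
  have hB : ⇑B = e := Module.Basis.coe_mk hli htop
  refine ⟨ι, Module.Finite.finite_basis B, B, deg, ?_, ?_⟩
  · rw [hB]
    refine le_antisymm (fun x hx => ?_) (Submodule.span_le.2 ?_)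
    · obtain ⟨γ, hγ⟩ := hV.exhaust x
      refine Submodule.span_mono ?_ (hle γ ⟨hγ, hx⟩)
      rintro _ ⟨i, k, -, rfl⟩
      exact ⟨(i, k), rfl⟩
    · rintro _ ⟨⟨i, k⟩, rfl⟩
      exact T_natCast_smul_mem hM k (hC.le_inf _ (he i)).2
  · rw [hB]
    funext β
    refine le_antisymm (fun x hx => ?_) (degFiltration_le fun i k hk => ?_)
    · obtain ⟨n, hn⟩ := hgen x
      have h1 := hle _ ⟨hV.shift β n x hx, hn⟩
      have h2 : natDegFiltration e deg (β + n) ≤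
          (degFiltration e deg β).comap (zpowMul E (-n)) := by
        refine Submodule.span_le.2 ?_
        rintro _ ⟨i, k, hk, rfl⟩
        change (T (-n) : L) • (T (k : ℤ) : L) • e i ∈ degFiltration e deg β
        rw [T_smul_T_smul]
        exact T_smul_mem_degFiltration e deg (by push_cast; linarith)
      have h3 : (T (-n) : L) • (T n : L) • x ∈ degFiltration e deg β := h2 h1
      rwa [T_neg_smul_T_smul] at h3
    · exact hV.mono hk (hV.shift _ k _ (hC.le_inf _ (he i)).1)

theorem IsFreeLattice.T_one_smul_mem {M : Submodule ℂ E} {r : ℕ}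
    (hM : IsFreeLattice (zmul E) M r) : ∀ x ∈ M, (T 1 : L) • x ∈ M := hM.1

theorem IsFreeLattice.exists_basis {M : Submodule ℂ E} {r : ℕ}
    (hM : IsFreeLattice (zmul E) M r) : ∃ b : Fin r → E,
      LinearIndependent ℂ (fun p : Fin r × ℤ => (T p.2 : L) • b p.1) ∧
      Submodule.span ℂ (Set.range fun p : Fin r × ℤ => (T p.2 : L) • b p.1) = ⊤ ∧
      Submodule.span ℂ (Set.range fun p : Fin r × ℕ => (T (p.2 : ℤ) : L) • b p.1) = M := by
  simpa only [zmul_zpow_apply] using hM.2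

theorem IsFreeLattice.module_finite {M : Submodule ℂ E} {r : ℕ}
    (hM : IsFreeLattice (zmul E) M r) : Module.Finite L E := by
  obtain ⟨b, -, htop, -⟩ := hM.exists_basis
  refine ⟨(Submodule.fg_def (R := L)).2 ⟨Set.range b, Set.finite_range b, ?_⟩⟩
  rw [eq_top_iff]
  intro x _
  have hle : Submodule.span ℂ (Set.range fun p : Fin r × ℤ => (T p.2 : L) • b p.1) ≤
      (Submodule.span L (Set.range b)).restrictScalars ℂ := by
    refine Submodule.span_le.2 ?_
    rintro _ ⟨p, rfl⟩
    exact Submodule.smul_mem _ _ (Submodule.subset_span (Set.mem_range_self p.1))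
  exact hle (htop ▸ Submodule.mem_top)

theorem IsFreeLattice.exists_T_smul_mem {M : Submodule ℂ E} {r : ℕ}
    (hM : IsFreeLattice (zmul E) M r) (x : E) : ∃ n : ℤ, (T n : L) • x ∈ M := by
  obtain ⟨b, -, htop, hspan⟩ := hM.exists_basis
  suffices h : ∃ n : ℕ, (T (n : ℤ) : L) • x ∈ M by
    obtain ⟨n, hn⟩ := h
    exact ⟨n, hn⟩
  have hx : x ∈ Submodule.span ℂ (Set.range fun p : Fin r × ℤ => (T p.2 : L) • b p.1) :=
    htop ▸ Submodule.mem_top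
  induction hx using Submodule.span_induction with
  | mem x h =>
    obtain ⟨⟨i, k⟩, rfl⟩ := h
    refine ⟨k.natAbs, ?_⟩
    rw [← hspan]
    refine Submodule.subset_span ⟨(i, (k.natAbs + k).toNat), ?_⟩
    simp only [T_smul_T_smul]
    congr 2
    omega
  | zero => exact ⟨0, by simp⟩
  | add x y _ _ hx hy =>
    obtain ⟨m, hm⟩ := hx
    obtain ⟨n, hn⟩ := hy
    refine ⟨m + n, ?_⟩
    have h1 := T_natCast_smul_mem hM.T_one_smul_mem n hm
    have h2 := T_natCast_smul_mem hM.T_one_smul_mem m hn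
    rw [T_smul_T_smul] at h1 h2
    rw [smul_add, Nat.cast_add]
    rw [add_comm] at h1
    exact add_mem h1 h2
  | smul c x _ hx =>
    obtain ⟨n, hn⟩ := hx
    exact ⟨n, by rw [smul_comm]; exact M.smul_mem c hn⟩

theorem IsFreeLattice.exists_inf_eq_bot {M : Submodule ℂ E} {r : ℕ}
    (hM : IsFreeLattice (zmul E) M r) {V : ℝ → Submodule ℂ E} {A : Finset ℝ}
    (hV : IsVLattice (zmul E) V A) : ∃ β, V β ⊓ M = ⊥ := by
  obtain ⟨b, hli, htop, hspan⟩ := hM.exists_basis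
  obtain ⟨c, hc⟩ := hV.exists_le (isShiftFiltration_degFiltration b (fun _ => 0) htop)
  refine ⟨-1 - c, ?_⟩
  have hdisj := hli.disjoint_span_image (s := {p | p.2 < 0}) (t := {p | 0 ≤ p.2})
    (Set.disjoint_left.2 fun p (hp : p.2 < 0) (hp' : 0 ≤ p.2) => absurd hp' (not_le.2 hp))
  refine disjoint_iff.1 (hdisj.mono ?_ ?_)
  · refine (hc _).trans (degFiltration_le fun i k hk => Submodule.subset_span ⟨(i, k), ?_, rfl⟩)
    have : (k : ℝ) < 0 := by linarith
    exact_mod_cast this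
  · rw [← hspan, Submodule.span_le]
    rintro _ ⟨⟨i, k⟩, rfl⟩
    exact Submodule.subset_span ⟨(i, (k : ℤ)), Int.natCast_nonneg k, rfl⟩

theorem span_T_smul_basis {ι : Type*} (B : Module.Basis ι L E) :
    Submodule.span ℂ (Set.range fun p : ι × ℤ => (T p.2 : L) • B p.1) = ⊤ := by
  rw [eq_top_iff, ← ((AddMonoidAlgebra.basis ℤ ℂ).smulTower B).span_eq, Submodule.span_le]
  rintro _ ⟨⟨k, i⟩, rfl⟩
  refine Submodule.subset_span ⟨(i, k), ?_⟩
  rw [Module.Basis.smulTower_apply, AddMonoidAlgebra.basis_apply]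
  rfl

theorem degFiltration_inf_le {ι : Type*} (B : Module.Basis ι L E) (deg : ι → ℝ) (β : ℝ) :
    degFiltration B deg β ⊓
      Submodule.span ℂ (Set.range fun p : ι × ℕ => (T (p.2 : ℤ) : L) • B p.1) ≤
        natDegFiltration B deg β := by
  set b := (AddMonoidAlgebra.basis ℤ ℂ).smulTower B with hb
  have hbapp : ∀ p, b p = (T p.1 : L) • B p.2 := fun p => by
    rw [hb, Module.Basis.smulTower_apply, AddMonoidAlgebra.basis_apply]
    rfl
  rintro x ⟨hx₁, hx₂⟩
  have h₁ : x ∈ Submodule.span ℂ (b '' {p | deg p.2 + p.1 ≤ β}) := by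
    refine degFiltration_le (fun i k hk => ?_) hx₁
    exact Submodule.subset_span ⟨(k, i), hk, hbapp _⟩
  have h₂ : x ∈ Submodule.span ℂ (b '' {p | 0 ≤ p.1}) := by
    refine Submodule.span_mono ?_ hx₂
    rintro _ ⟨⟨i, k⟩, rfl⟩
    exact ⟨((k : ℤ), i), Int.natCast_nonneg k, hbapp _⟩
  have h₃ : x ∈ Submodule.span ℂ (b '' ({p | deg p.2 + p.1 ≤ β} ∩ {p | 0 ≤ p.1})) :=
    b.mem_span_image.2 (Set.subset_inter (b.mem_span_image.1 h₁) (b.mem_span_image.1 h₂))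
  refine Submodule.span_mono ?_ h₃
  rintro _ ⟨⟨k, i⟩, ⟨hk, hk0⟩, rfl⟩
  obtain ⟨n, rfl⟩ := Int.eq_ofNat_of_zero_le hk0
  exact ⟨i, n, by simpa using hk, hbapp _⟩

end Filtrations

section Tensor

theorem T_smul_tmul_T_smul {P Q : Type*} [AddCommGroup P] [Module L P] [AddCommGroup Q]
    [Module L Q] (k l : ℤ) (x : P) (y : Q) :
    ((T k : L) • x) ⊗ₜ[L] ((T l : L) • y) = (T (k + l) : L) • (x ⊗ₜ[L] y) := by
  rw [TensorProduct.smul_tmul_smul, ← T_add]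

theorem tmul_mem_of_mem_span {S : Set N₁} {S' : Set N₂} {P : Submodule ℂ (N₁ ⊗[L] N₂)}
    (h : ∀ s ∈ S, ∀ t ∈ S', s ⊗ₜ[L] t ∈ P) {a : N₁} (ha : a ∈ Submodule.span ℂ S) {b : N₂}
    (hb : b ∈ Submodule.span ℂ S') : a ⊗ₜ[L] b ∈ P := by
  have h₁ : ∀ s ∈ S, Submodule.span ℂ S' ≤
      P.comap (((TensorProduct.mk L N₁ N₂) s).restrictScalars ℂ) := fun s hs =>
    Submodule.span_le.2 fun t ht => h s hs t ht
  have h₂ : Submodule.span ℂ S ≤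
      P.comap (((TensorProduct.mk L N₁ N₂).flip b).restrictScalars ℂ) :=
    Submodule.span_le.2 fun s hs => h₁ s hs hb
  exact h₂ ha

variable {ι₁ ι₂ : Type*} (B₁ : Module.Basis ι₁ L N₁) (B₂ : Module.Basis ι₂ L N₂)
  (deg₁ : ι₁ → ℝ) (deg₂ : ι₂ → ℝ)

/-- The filtration on the tensor product attached to the tensor product of two homogeneous bases. -/
def tensorDegFiltration (β : ℝ) : Submodule ℂ (N₁ ⊗[L] N₂) :=
  degFiltration (B₁.tensorProduct B₂) (fun p => deg₁ p.1 + deg₂ p.2) β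

theorem tmul_mem_tensorDegFiltration {β₁ β₂ β : ℝ} (h : β₁ + β₂ = β) {a : N₁} {b : N₂}
    (ha : a ∈ degFiltration B₁ deg₁ β₁) (hb : b ∈ degFiltration B₂ deg₂ β₂) :
    a ⊗ₜ[L] b ∈ tensorDegFiltration B₁ B₂ deg₁ deg₂ β := by
  refine tmul_mem_of_mem_span ?_ ha hb
  rintro _ ⟨i, k, hk, rfl⟩ _ ⟨j, l, hl, rfl⟩
  rw [T_smul_tmul_T_smul, ← Module.Basis.tensorProduct_apply]
  exact T_smul_mem_degFiltration _ _ (i := (i, j)) (by push_cast; linarith)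

set_option linter.unusedSectionVars false in
theorem tensorDegFiltration_le {β : ℝ} {P : Submodule ℂ (N₁ ⊗[L] N₂)}
    (h : ∀ β₁ β₂, β₁ + β₂ = β → ∀ a ∈ degFiltration B₁ deg₁ β₁, ∀ b ∈ degFiltration B₂ deg₂ β₂,
      a ⊗ₜ[L] b ∈ P) : tensorDegFiltration B₁ B₂ deg₁ deg₂ β ≤ P := by
  refine degFiltration_le ?_
  rintro ⟨i, j⟩ k hk
  have := h (β - deg₂ j) (deg₂ j) (sub_add_cancel _ _) ((T k : L) • B₁ i)
    (T_smul_mem_degFiltration _ _ (by linarith)) ((T 0 : L) • B₂ j)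
    (T_smul_mem_degFiltration _ _ (by simp))
  rwa [T_smul_tmul_T_smul, add_zero, ← Module.Basis.tensorProduct_apply] at this

variable {B₁ B₂ deg₁ deg₂}

theorem tensorDegFiltration_inf_eq {M₁ : Submodule ℂ N₁} {M₂ : Submodule ℂ N₂}
    (hM₁ : M₁ = Submodule.span ℂ (Set.range fun p : ι₁ × ℕ => (T (p.2 : ℤ) : L) • B₁ p.1))
    (hM₂ : M₂ = Submodule.span ℂ (Set.range fun p : ι₂ × ℕ => (T (p.2 : ℤ) : L) • B₂ p.1))
    (β : ℝ) :
    tensorDegFiltration B₁ B₂ deg₁ deg₂ β ⊓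
        Submodule.span ℂ {x : N₁ ⊗[L] N₂ | ∃ a ∈ M₁, ∃ b ∈ M₂, x = a ⊗ₜ[L] b} =
      ⨆ (p : ℝ × ℝ) (_ : p.1 + p.2 = β), Submodule.span ℂ
        {x : N₁ ⊗[L] N₂ | ∃ a ∈ degFiltration B₁ deg₁ p.1 ⊓ M₁,
          ∃ b ∈ degFiltration B₂ deg₂ p.2 ⊓ M₂, x = a ⊗ₜ[L] b} := by
  refine le_antisymm ?_ (iSup₂_le fun p hp => Submodule.span_le.2 ?_)
  · have hM : Submodule.span ℂ {x : N₁ ⊗[L] N₂ | ∃ a ∈ M₁, ∃ b ∈ M₂, x = a ⊗ₜ[L] b} ≤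
        Submodule.span ℂ (Set.range fun p : (ι₁ × ι₂) × ℕ =>
          (T (p.2 : ℤ) : L) • B₁.tensorProduct B₂ p.1) := by
      refine Submodule.span_le.2 ?_
      rintro _ ⟨a, ha, b, hb, rfl⟩
      rw [hM₁] at ha
      rw [hM₂] at hb
      refine tmul_mem_of_mem_span ?_ ha hb
      rintro _ ⟨⟨i, k⟩, rfl⟩ _ ⟨⟨j, l⟩, rfl⟩
      beta_reduce
      rw [T_smul_tmul_T_smul, ← Module.Basis.tensorProduct_apply, ← Nat.cast_add]
      exact Submodule.subset_span (Set.mem_range_self ((i, j), k + l))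
    refine (inf_le_inf_left _ hM).trans ((degFiltration_inf_le _ _ β).trans ?_)
    refine Submodule.span_le.2 ?_
    rintro _ ⟨⟨i, j⟩, k, hk, rfl⟩
    refine Submodule.mem_iSup_of_mem (β - deg₂ j, deg₂ j)
      (Submodule.mem_iSup_of_mem (sub_add_cancel _ _) (Submodule.subset_span ?_))
    refine ⟨(T (k : ℤ) : L) • B₁ i, ⟨T_smul_mem_degFiltration _ _ ?_, ?_⟩,
      (T 0 : L) • B₂ j, ⟨T_smul_mem_degFiltration _ _ ?_, ?_⟩, ?_⟩
    · push_cast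
      linarith
    · rw [hM₁]
      exact Submodule.subset_span ⟨(i, k), rfl⟩
    · simp
    · rw [hM₂]
      exact Submodule.subset_span ⟨(j, 0), rfl⟩
    · rw [T_smul_tmul_T_smul, add_zero, Module.Basis.tensorProduct_apply]
  · rintro _ ⟨a, ha, b, hb, rfl⟩
    exact ⟨tmul_mem_tensorDegFiltration B₁ B₂ deg₁ deg₂ hp ha.1 hb.1,
      Submodule.subset_span ⟨a, ha.2, b, hb.2, rfl⟩⟩

variable {nab₁ : N₁ →ₗ[ℂ] N₁} {nab₂ : N₂ →ₗ[ℂ] N₂} {nabla : N₁ ⊗[L] N₂ →ₗ[ℂ] N₁ ⊗[L] N₂}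

theorem nabla_mem_tensorDegFiltration
    (hnabla : ∀ (x : N₁) (y : N₂), nabla (x ⊗ₜ[L] y) = (nab₁ x) ⊗ₜ[L] y + x ⊗ₜ[L] (nab₂ y))
    (hstab₁ : ∀ β, ∀ x ∈ degFiltration B₁ deg₁ β, nab₁ x ∈ degFiltration B₁ deg₁ β)
    (hstab₂ : ∀ β, ∀ y ∈ degFiltration B₂ deg₂ β, nab₂ y ∈ degFiltration B₂ deg₂ β)
    (β : ℝ) (u : N₁ ⊗[L] N₂) (hu : u ∈ tensorDegFiltration B₁ B₂ deg₁ deg₂ β) :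
    nabla u ∈ tensorDegFiltration B₁ B₂ deg₁ deg₂ β := by
  have : tensorDegFiltration B₁ B₂ deg₁ deg₂ β ≤
      (tensorDegFiltration B₁ B₂ deg₁ deg₂ β).comap nabla := by
    refine tensorDegFiltration_le _ _ _ _ fun β₁ β₂ h a ha b hb => ?_
    rw [Submodule.mem_comap, hnabla]
    exact add_mem (tmul_mem_tensorDegFiltration _ _ _ _ h (hstab₁ _ a ha) hb)
      (tmul_mem_tensorDegFiltration _ _ _ _ h ha (hstab₂ _ b hb))
  exact this hu

set_option linter.unusedSectionVars false in
/-- Leibniz rule for nilpotency: if the `p`-th power on the left factor and the `q`-th power on the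
right factor land in the subspaces `Q₁` and `Q₂`, the `(p + q)`-th power lands in `P`. -/
theorem pow_tmul_mem {D₁ : N₁ →ₗ[ℂ] N₁} {D₂ : N₂ →ₗ[ℂ] N₂}
    {D : N₁ ⊗[L] N₂ →ₗ[ℂ] N₁ ⊗[L] N₂}
    (hD : ∀ (x : N₁) (y : N₂), D (x ⊗ₜ[L] y) = (D₁ x) ⊗ₜ[L] y + x ⊗ₜ[L] (D₂ y))
    {P₁ Q₁ : Submodule ℂ N₁} {P₂ Q₂ : Submodule ℂ N₂} {P : Submodule ℂ (N₁ ⊗[L] N₂)}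
    (hP₁ : ∀ x ∈ P₁, D₁ x ∈ P₁) (hP₂ : ∀ y ∈ P₂, D₂ y ∈ P₂) (hP : ∀ u ∈ P, D u ∈ P)
    (hQ₁ : ∀ x ∈ Q₁, ∀ y ∈ P₂, x ⊗ₜ[L] y ∈ P) (hQ₂ : ∀ x ∈ P₁, ∀ y ∈ Q₂, x ⊗ₜ[L] y ∈ P)
    (p q : ℕ) (a : N₁) (b : N₂) (ha : a ∈ P₁) (hb : b ∈ P₂) (hap : (D₁ ^ p) a ∈ Q₁)
    (hbq : (D₂ ^ q) b ∈ Q₂) : (D ^ (p + q)) (a ⊗ₜ[L] b) ∈ P := by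
  induction p generalizing q a b with
  | zero => exact Module.End.pow_apply_mem_of_forall_mem _ hP _ (hQ₁ a hap b hb)
  | succ p ihp =>
    induction q generalizing a b with
    | zero => exact Module.End.pow_apply_mem_of_forall_mem _ hP _ (hQ₂ a ha b hbq)
    | succ q ihq =>
      rw [← add_assoc, pow_succ, Module.End.mul_apply, hD, map_add]
      rw [pow_succ, Module.End.mul_apply] at hap hbq
      refine add_mem ?_ (ihq a (D₂ b) ha (hP₂ b hb) ?_ hbq)
      · rw [add_right_comm]
        exact ihp (q + 1) (D₁ a) b (hP₁ a ha) hb hap (by rwa [pow_succ, Module.End.mul_apply])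
      · rwa [pow_succ, Module.End.mul_apply]

theorem pow_nabla_mem_Vlt_tensorDegFiltration [Finite ι₁] [Finite ι₂]
    (hnabla : ∀ (x : N₁) (y : N₂), nabla (x ⊗ₜ[L] y) = (nab₁ x) ⊗ₜ[L] y + x ⊗ₜ[L] (nab₂ y))
    (hstab₁ : ∀ β, ∀ x ∈ degFiltration B₁ deg₁ β, nab₁ x ∈ degFiltration B₁ deg₁ β)
    (hstab₂ : ∀ β, ∀ y ∈ degFiltration B₂ deg₂ β, nab₂ y ∈ degFiltration B₂ deg₂ β)
    {ν₁ ν₂ : ℕ}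
    (hnil₁ : ∀ β : ℝ, ∀ x ∈ degFiltration B₁ deg₁ β,
      ((nab₁ + (β : ℂ) • (LinearMap.id : N₁ →ₗ[ℂ] N₁)) ^ ν₁) x ∈ Vlt (degFiltration B₁ deg₁) β)
    (hnil₂ : ∀ β : ℝ, ∀ y ∈ degFiltration B₂ deg₂ β,
      ((nab₂ + (β : ℂ) • (LinearMap.id : N₂ →ₗ[ℂ] N₂)) ^ ν₂) y ∈ Vlt (degFiltration B₂ deg₂) β)
    (β : ℝ) (u : N₁ ⊗[L] N₂) (hu : u ∈ tensorDegFiltration B₁ B₂ deg₁ deg₂ β) :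
    ((nabla + (β : ℂ) • (LinearMap.id : N₁ ⊗[L] N₂ →ₗ[ℂ] N₁ ⊗[L] N₂)) ^ (ν₁ + ν₂)) u ∈
      Vlt (tensorDegFiltration B₁ B₂ deg₁ deg₂) β := by
  have hV₁ := isShiftFiltration_degFiltration B₁ deg₁ (span_T_smul_basis B₁)
  have hV₂ := isShiftFiltration_degFiltration B₂ deg₂ (span_T_smul_basis B₂)
  have hU : IsShiftFiltration (tensorDegFiltration B₁ B₂ deg₁ deg₂) :=
    isShiftFiltration_degFiltration _ _ (span_T_smul_basis _)
  have hle : tensorDegFiltration B₁ B₂ deg₁ deg₂ β ≤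
      (Vlt (tensorDegFiltration B₁ B₂ deg₁ deg₂) β).comap
        ((nabla + (β : ℂ) • (LinearMap.id : N₁ ⊗[L] N₂ →ₗ[ℂ] N₁ ⊗[L] N₂)) ^ (ν₁ + ν₂)) := by
    refine tensorDegFiltration_le _ _ _ _ fun β₁ β₂ h a ha b hb => ?_
    rw [Submodule.mem_comap]
    refine pow_tmul_mem (D₁ := nab₁ + (β₁ : ℂ) • LinearMap.id)
      (D₂ := nab₂ + (β₂ : ℂ) • LinearMap.id) (fun x y => ?_)
      (fun x hx => add_mem (hstab₁ β₁ x hx) (Submodule.smul_mem _ _ hx))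
      (fun y hy => add_mem (hstab₂ β₂ y hy) (Submodule.smul_mem _ _ hy))
      (fun u hu => ?_) (fun x hx y hy => ?_) (fun x hx y hy => ?_) ν₁ ν₂ a b ha hb
      (hnil₁ β₁ a ha) (hnil₂ β₂ b hb)
    · simp only [LinearMap.add_apply, LinearMap.smul_apply, LinearMap.id_apply, hnabla,
        TensorProduct.add_tmul, TensorProduct.tmul_add, ← h, Complex.ofReal_add, add_smul,
        TensorProduct.smul_tmul', TensorProduct.tmul_smul]
      abel
    · obtain ⟨γ, hγ, hu⟩ := hU.mem_Vlt.1 hu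
      exact le_Vlt _ hγ (add_mem (nabla_mem_tensorDegFiltration hnabla hstab₁ hstab₂ γ u hu)
        (Submodule.smul_mem _ _ hu))
    · obtain ⟨γ, hγ, hx⟩ := hV₁.mem_Vlt.1 hx
      exact le_Vlt _ (by linarith) (tmul_mem_tensorDegFiltration _ _ _ _ (β := γ + β₂) rfl hx hy)
    · obtain ⟨γ, hγ, hy⟩ := hV₂.mem_Vlt.1 hy
      exact le_Vlt _ (by linarith) (tmul_mem_tensorDegFiltration _ _ _ _ (β := β₁ + γ) rfl hx hy)
  exact hle hu

end Tensor

/-- Proposition 3.2.11 (tensor product formula for the irregular Hodge filtration).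
Let `W` be any V-lattice filtration on `N = N₁ ⊗_{ℂ[z,z⁻¹]} N₂` stable under the
tensor-product connection `∇` and with `(∇ + β·id)^ν (W_β) ⊆ W_{<β}`.  Under the
canonical isomorphism `H := M/(z−1)M ≅ H₁ ⊗_ℂ H₂`, the irregular Hodge filtration
`F^irr_β H := image of W_β ∩ M in H` satisfies
`F^irr_β H = Σ_{β₁+β₂=β} F^irr_{β₁} H₁ ⊗_ℂ F^irr_{β₂} H₂`; equivalently, inside `N` and
modulo `(z−1)·M`:
`(W_β ∩ M) + (z−1)M = (Σ_{β₁+β₂=β} span{m₁ ⊗ m₂ : mᵢ ∈ Vⁱ_{βᵢ} ∩ Mᵢ}) + (z−1)M`. -/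
theorem statement10
    (M₁ : Submodule ℂ N₁) (M₂ : Submodule ℂ N₂) (r₁ r₂ : ℕ)
    (V₁ : ℝ → Submodule ℂ N₁) (V₂ : ℝ → Submodule ℂ N₂) (A₁ A₂ : Finset ℝ)
    (hM₁ : IsFreeLattice (zmul N₁) M₁ r₁) (hM₂ : IsFreeLattice (zmul N₂) M₂ r₂)
    (hV₁ : IsVLattice (zmul N₁) V₁ A₁) (hV₂ : IsVLattice (zmul N₂) V₂ A₂)
    (nab₁ : N₁ →ₗ[ℂ] N₁) (nab₂ : N₂ →ₗ[ℂ] N₂)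
    -- the Leibniz rule `∇(f·n) = −z·(df/dz)·n + f·∇(n)` (on the generator `f = z`,
    -- which determines it for all `f ∈ ℂ[z,z⁻¹]`):
    (hLeib₁ : ∀ x : N₁, nab₁ ((T 1 : L) • x) = (T 1 : L) • nab₁ x - (T 1 : L) • x)
    (hLeib₂ : ∀ y : N₂, nab₂ ((T 1 : L) • y) = (T 1 : L) • nab₂ y - (T 1 : L) • y)
    -- `z·∇ᵢ(Mᵢ) ⊆ Mᵢ`:
    (hMnab₁ : ∀ m ∈ M₁, (T 1 : L) • nab₁ m ∈ M₁)
    (hMnab₂ : ∀ m ∈ M₂, (T 1 : L) • nab₂ m ∈ M₂)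
    (hstab₁ : ∀ β : ℝ, ∀ x ∈ V₁ β, nab₁ x ∈ V₁ β)
    (hstab₂ : ∀ β : ℝ, ∀ y ∈ V₂ β, nab₂ y ∈ V₂ β)
    (ν₁ ν₂ : ℕ)
    (hnil₁ : ∀ β : ℝ, ∀ x ∈ V₁ β,
      ((nab₁ + (β : ℂ) • (LinearMap.id : N₁ →ₗ[ℂ] N₁)) ^ ν₁) x ∈ Vlt V₁ β)
    (hnil₂ : ∀ β : ℝ, ∀ y ∈ V₂ β,
      ((nab₂ + (β : ℂ) • (LinearMap.id : N₂ →ₗ[ℂ] N₂)) ^ ν₂) y ∈ Vlt V₂ β)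
    -- the (unique) tensor-product connection on `N = N₁ ⊗_{ℂ[z,z⁻¹]} N₂`:
    (nabla : N₁ ⊗[L] N₂ →ₗ[ℂ] N₁ ⊗[L] N₂)
    (hnabla : ∀ (x : N₁) (y : N₂),
      nabla (x ⊗ₜ[L] y) = (nab₁ x) ⊗ₜ[L] y + x ⊗ₜ[L] (nab₂ y))
    -- `W` is any V-lattice filtration on `N` stable under `∇` with
    -- `(∇ + β·id)^ν (W_β) ⊆ W_{<β}`:
    (W : ℝ → Submodule ℂ (N₁ ⊗[L] N₂)) (AW : Finset ℝ)
    (hW : IsVLattice (zmul (N₁ ⊗[L] N₂)) W AW)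
    (hWnab : ∀ β : ℝ, ∀ u ∈ W β, nabla u ∈ W β)
    (ν : ℕ)
    (hWnil : ∀ β : ℝ, ∀ u ∈ W β,
      ((nabla + (β : ℂ) • (LinearMap.id : N₁ ⊗[L] N₂ →ₗ[ℂ] N₁ ⊗[L] N₂)) ^ ν) u ∈
        Vlt W β) :
    ∀ β : ℝ,
      (W β ⊓ Submodule.span ℂ {x : N₁ ⊗[L] N₂ | ∃ a ∈ M₁, ∃ b ∈ M₂, x = a ⊗ₜ[L] b}) ⊔
          (Submodule.span ℂ {x : N₁ ⊗[L] N₂ | ∃ a ∈ M₁, ∃ b ∈ M₂, x = a ⊗ₜ[L] b}).map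
            ((zmul (N₁ ⊗[L] N₂)).toLinearMap - LinearMap.id) =
        (⨆ (p : ℝ × ℝ) (_ : p.1 + p.2 = β),
            Submodule.span ℂ
              {x : N₁ ⊗[L] N₂ | ∃ a ∈ V₁ p.1 ⊓ M₁, ∃ b ∈ V₂ p.2 ⊓ M₂, x = a ⊗ₜ[L] b}) ⊔
          (Submodule.span ℂ {x : N₁ ⊗[L] N₂ | ∃ a ∈ M₁, ∃ b ∈ M₂, x = a ⊗ₜ[L] b}).map
            ((zmul (N₁ ⊗[L] N₂)).toLinearMap - LinearMap.id) := by
  have := hM₁.module_finite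
  have := hM₂.module_finite
  obtain ⟨ι₁, _, B₁, deg₁, hMB₁, rfl⟩ := hV₁.isShiftFiltration.exists_adapted_basis
    hM₁.T_one_smul_mem hM₁.exists_T_smul_mem (hM₁.exists_inf_eq_bot hV₁)
  obtain ⟨ι₂, _, B₂, deg₂, hMB₂, rfl⟩ := hV₂.isShiftFiltration.exists_adapted_basis
    hM₂.T_one_smul_mem hM₂.exists_T_smul_mem (hM₂.exists_inf_eq_bot hV₂)
  have hU : IsShiftFiltration (tensorDegFiltration B₁ B₂ deg₁ deg₂) :=
    isShiftFiltration_degFiltration _ _ (span_T_smul_basis _)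
  have hUnab := nabla_mem_tensorDegFiltration hnabla hstab₁ hstab₂
  have hUnil := pow_nabla_mem_Vlt_tensorDegFiltration hnabla hstab₁ hstab₂ hnil₁ hnil₂
  intro β
  have hWU : W β = tensorDegFiltration B₁ B₂ deg₁ deg₂ β :=
    le_antisymm
      (le_of_regular hW.isShiftFiltration hU nabla hUnab hWnil hUnil (hW.exists_le hU) β)
      (le_of_regular hU hW.isShiftFiltration nabla hWnab hUnil hWnil
        (hW.isShiftFiltration.exists_degFiltration_le _ _) β)
  rw [hWU, tensorDegFiltration_inf_eq hMB₁ hMB₂]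
end
end

section
/- For every β ∈ ℝ one has V_β ∩ (1−z)·M = (1−z)·(V_{β−1} ∩ M) as ℂ-subspaces of N. (Strictness computation in the proof of Proposition 2.4.2 of 'Irregular Hodge theory', showing that the quotient by (τ−z) of the rescaled V-filtration is strict.) -/
noncomputable section

open Submodule Set

variable {N : Type*} [AddCommGroup N] [Module ℂ N]

/-- The Harder–Narasimhan filtration of `N`: `F^HN_β(N)` is the `ℂ[z,z⁻¹]`-span of
`V_β ∩ M`. -/
def FHN (z : N ≃ₗ[ℂ] N) (V : ℝ → Submodule ℂ N) (M : Submodule ℂ N) (β : ℝ) :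
    Submodule ℂ N :=
  Submodule.span ℂ {x : N | ∃ k : ℤ, ∃ v ∈ V β ⊓ M, x = (z ^ k) v}

namespace IsVLattice

variable {z : N ≃ₗ[ℂ] N} {V : ℝ → Submodule ℂ N} {A : Finset ℝ}

theorem apply_mem (hV : IsVLattice z V A) {γ : ℝ} {x : N} (hx : x ∈ V γ) :
    z x ∈ V (γ + 1) :=
  hV.map_z γ ▸ Submodule.mem_map_of_mem (f := z.toLinearMap) hx

theorem mem_of_apply_mem (hV : IsVLattice z V A) {γ : ℝ} {x : N} (hx : z x ∈ V (γ + 1)) :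
    x ∈ V γ := by
  rw [← hV.map_z γ] at hx
  obtain ⟨y, hy, hyx⟩ := hx
  exact z.injective hyx ▸ hy

theorem pow_apply_mem (hV : IsVLattice z V A) {γ : ℝ} {x : N} (hx : x ∈ V γ) (n : ℕ) :
    (z ^ n) x ∈ V (γ + n) := by
  induction n with
  | zero => simpa using hx
  | succ n ih =>
    rw [pow_succ', LinearEquiv.mul_apply, Nat.cast_succ, ← add_assoc]
    exact hV.apply_mem ih

theorem inv_pow_apply_mem (hV : IsVLattice z V A) {γ : ℝ} {x : N} (hx : x ∈ V γ) (n : ℕ) :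
    (z⁻¹ ^ n) x ∈ V γ := by
  induction n with
  | zero => simpa using hx
  | succ n ih =>
    rw [pow_succ', LinearEquiv.mul_apply]
    exact hV.zinv_stable γ _ ih

theorem exists_mem_add_natCast (hV : IsVLattice z V A) (γ : ℝ) (x : N) :
    ∃ n : ℕ, x ∈ V (γ + n) := by
  have hx : x ∈ Submodule.span ℂ {x : N | ∃ k : ℤ, ∃ v ∈ V γ, x = (z ^ k) v} :=
    hV.span_laurent γ ▸ Submodule.mem_top
  induction hx using Submodule.span_induction with
  | mem x h =>
    obtain ⟨k, v, hv, rfl⟩ := h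
    obtain ⟨n, rfl | rfl⟩ := k.eq_nat_or_neg
    · exact ⟨n, by simpa using hV.pow_apply_mem hv n⟩
    · exact ⟨0, by simpa using hV.inv_pow_apply_mem hv n⟩
  | zero => exact ⟨0, zero_mem _⟩
  | add x y _ _ hx hy =>
    obtain ⟨m, hm⟩ := hx
    obtain ⟨n, hn⟩ := hy
    refine ⟨max m n, add_mem (hV.mono ?_ hm) (hV.mono ?_ hn)⟩ <;> gcongr <;> simp
  | smul c x _ hx =>
    obtain ⟨n, hn⟩ := hx
    exact ⟨n, Submodule.smul_mem _ c hn⟩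

theorem mem_of_sub_apply_mem (hV : IsVLattice z V A) {γ : ℝ} {x : N}
    (hx : x - z x ∈ V (γ + 1)) : x ∈ V γ := by
  obtain ⟨n, hn⟩ := hV.exists_mem_add_natCast γ x
  induction n with
  | zero => simpa using hn
  | succ n ih =>
    rw [Nat.cast_succ, ← add_assoc] at hn
    have hle : γ + 1 ≤ γ + n + 1 := by simp
    refine ih (hV.mem_of_apply_mem ?_)
    simpa using sub_mem hn (hV.mono hle hx)

theorem sub_apply_mem_iff (hV : IsVLattice z V A) {γ : ℝ} {x : N} :
    x - z x ∈ V (γ + 1) ↔ x ∈ V γ :=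
  ⟨hV.mem_of_sub_apply_mem, fun hx => sub_mem (hV.mono (by simp) hx) (hV.apply_mem hx)⟩

end IsVLattice

/-- Strictness computation in the proof of Proposition 2.4.2: for every `β ∈ ℝ`,
`V_β ∩ (1−z)·M = (1−z)·(V_{β−1} ∩ M)` as `ℂ`-subspaces of `N`. -/
theorem statement14 (z : N ≃ₗ[ℂ] N) (M : Submodule ℂ N) (r : ℕ)
    (V : ℝ → Submodule ℂ N) (A : Finset ℝ)
    (hM : IsFreeLattice z M r) (hV : IsVLattice z V A) :
    ∀ β : ℝ,
      V β ⊓ M.map (LinearMap.id - z.toLinearMap) =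
        (V (β - 1) ⊓ M).map (LinearMap.id - z.toLinearMap) := by
  intro β
  have key (x : N) : x - z x ∈ V β ↔ x ∈ V (β - 1) := by
    simpa using hV.sub_apply_mem_iff (γ := β - 1) (x := x)
  ext y
  constructor
  · rintro ⟨hy, x, hxM, rfl⟩
    exact ⟨x, ⟨(key x).1 hy, hxM⟩, rfl⟩
  · rintro ⟨x, ⟨hx, hxM⟩, rfl⟩
    exact ⟨(key x).2 hx, x, hxM, rfl⟩
end
end
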